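/- arXiv:1912.07965 — 4 statements merged into one kernel-verified Lean document; each statement's English description precedes it below -/
import Mathlib

section
/- For every finite graph G and every nonnegative integer k, either G contains k pairwise edge-disjoint cycles, or there is a set F of at most k·(8⌈log₂ k⌉ + 2) edges of G such that the graph G − F (obtained by deleting the edges in F) has no cycle. -/
namespace EP
open Finset Module
set_option linter.unusedSectionVars false

abbrev F2 := ZMod 2

section
variable {V E : Type*} [Fintype V] [Fintype E] [DecidableEq V] [DecidableEq E]

/-- mod-2 boundary of an edge vector -/
noncomputable def bd (s t : E → V) : (E → F2) →ₗ[F2] (V → F2) :=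
  Fintype.linearCombination F2 (fun e => Pi.single (s e) (1 : F2) + Pi.single (t e) 1)

/-- cycle space supported on `D` -/
noncomputable def Z (s t : E → V) (D : Finset E) : Submodule F2 (E → F2) where
  carrier := {x | (∀ e, e ∉ D → x e = 0) ∧ bd s t x = 0}
  add_mem' := by
    rintro a b ⟨h1, h2⟩ ⟨h3, h4⟩
    exact ⟨fun e he => by simp [h1 e he, h3 e he], by simp [h2, h4]⟩
  zero_mem' := by simp
  smul_mem' := by
    rintro c a ⟨h1, h2⟩
    exact ⟨fun e he => by simp [h1 e he], by simp [h2]⟩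

/-- support -/
def supp (x : E → F2) : Finset E := univ.filter (fun e => x e ≠ 0)

lemma mem_supp (x : E → F2) (e : E) : e ∈ supp x ↔ x e ≠ 0 := by simp [supp]

lemma mem_Z (s t : E → V) (D : Finset E) (x : E → F2) :
    x ∈ Z s t D ↔ (∀ e, e ∉ D → x e = 0) ∧ bd s t x = 0 := Iff.rfl

lemma bd_single (s t : E → V) (e : E) (c : F2) :
    bd s t (Pi.single e c) = c • (Pi.single (s e) (1 : F2) + Pi.single (t e) 1) := by
  simp [bd, Fintype.linearCombination_apply_single]

lemma bd_apply (s t : E → V) (x : E → F2) (v : V) :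
    bd s t x v = ∑ e, x e * ((if s e = v then 1 else 0) + (if t e = v then 1 else 0)) := by
  simp [bd, Fintype.linearCombination_apply, Finset.sum_apply, Pi.single_apply, eq_comm, mul_add]

lemma F2_self {M : Type*} [AddCommGroup M] [Module F2 M] (a : M) : a + a = 0 := by
  have : (2 : F2) • a = 0 := by
    have : (2 : F2) = 0 := by decide
    rw [this, zero_smul]
  rwa [two_smul] at this

lemma F2_one {a : F2} (h : a ≠ 0) : a = 1 := by revert a; decide

lemma drop {M ι : Type*} [AddCommGroup M] [Module F2 M] [FiniteDimensional F2 M]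
    (W W' : Submodule F2 M) (S : Finset ι) (φ : ι → M →ₗ[F2] F2)
    (h : ∀ x ∈ W, (∀ i ∈ S, φ i x = 0) → x ∈ W') : finrank F2 W ≤ finrank F2 W' + S.card := by
  let g : W →ₗ[F2] (S → F2) := LinearMap.pi (fun i => (φ i).comp W.subtype)
  have h1 := LinearMap.finrank_range_add_finrank_ker g
  have h2 : finrank F2 (LinearMap.range g) ≤ S.card := by
    have := Submodule.finrank_le (LinearMap.range g)
    simpa using this
  have h3 : finrank F2 (LinearMap.ker g) ≤ finrank F2 W' := by
    have h4 : (LinearMap.ker g).map W.subtype ≤ W' := by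
      rintro _ ⟨x, hx, rfl⟩
      apply h _ x.2
      intro i hi
      have := congrFun (LinearMap.mem_ker.1 hx) ⟨i, hi⟩
      simpa [g] using this
    have h5 := Submodule.finrank_mono h4
    rwa [← (Submodule.equivMapOfInjective W.subtype W.injective_subtype (LinearMap.ker g)).finrank_eq] at h5
  omega

lemma Z_mono (s t : E → V) {D D' : Finset E} (h : D ⊆ D') : Z s t D ≤ Z s t D' :=
  fun _ hx => ⟨fun e he => hx.1 e (fun h' => he (h h')), hx.2⟩

lemma Z_del (s t : E → V) (D S : Finset E) :
    finrank F2 (Z s t D) ≤ finrank F2 (Z s t (D \ S)) + S.card := by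
  apply drop _ _ S (fun e => LinearMap.proj e)
  intro x hx h
  refine ⟨fun e he => ?_, hx.2⟩
  by_cases h1 : e ∈ S
  · exact h e h1
  · exact hx.1 e (fun h2 => he (by simp [h1, h2]))

/-- edges at a vertex -/
def inc (s t : E → V) (D : Finset E) (v : V) : Finset E := D.filter (fun e => s e = v ∨ t e = v)

lemma Z_lower (s t : E → V) (D : Finset E) :
    D.card ≤ finrank F2 (Z s t D) + (univ.filter (fun v => (inc s t D v).Nonempty)).card := by
  classical
  have := drop (⊤ : Submodule F2 (E → F2)) (Z s t D)
    ((Dᶜ).disjSum (univ.filter (fun v => (inc s t D v).Nonempty)))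
    (Sum.elim (fun e => LinearMap.proj e) (fun v => (LinearMap.proj v).comp (bd s t)))
    (by
      intro x _ h
      have h0 : ∀ e, e ∉ D → x e = 0 := fun e he => by
        simpa using h (Sum.inl e) (by simp [he])
      refine ⟨h0, ?_⟩
      ext v
      by_cases hv : (inc s t D v).Nonempty
      · simpa using h (Sum.inr v) (by simpa using hv)
      · rw [bd_apply]
        apply Finset.sum_eq_zero
        intro e _
        by_cases he : e ∈ D
        · rw [Finset.not_nonempty_iff_eq_empty] at hv
          have h3 : e ∉ inc s t D v := by simp [hv]
          simp only [inc, mem_filter, he, true_and, not_or] at h3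
          simp [h3.1, h3.2]
        · simp [h0 e he])
  have h2 := Finset.card_compl_add_card D
  simp only [Finset.card_disjSum, finrank_top, Module.finrank_fintype_fun_eq_card] at this
  have := Finset.card_le_univ D
  omega

lemma supp_add (x y : E → F2) : (supp (x + y)).card ≤ (supp x).card + (supp y).card := by
  refine le_trans (card_le_card ?_) (card_union_le _ _)
  intro e
  simp only [mem_supp, mem_union, Pi.add_apply]
  intro h
  by_contra! h2
  simp [h2.1, h2.2] at h

lemma supp_single (e : E) : (supp (Pi.single e (1 : F2))).card ≤ 1 := by
  have : supp (Pi.single e (1 : F2)) ⊆ {e} := by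
    intro f hf
    rw [mem_supp] at hf
    by_contra h
    simp only [mem_singleton] at h
    simp [h] at hf
  simpa using card_le_card this

/-- Moore-type bound: in a multigraph whose nonisolated vertices have degree at least
three there is a short nonzero cycle-space vector. -/
lemma moore (s t : E → V) (D : Finset E)
    (h3 : ∀ v, (inc s t D v).Nonempty → 3 ≤ (inc s t D v).card)
    (v0 : V) (hv0 : (inc s t D v0).Nonempty) (r : ℕ)
    (hr : (univ.filter (fun v => (inc s t D v).Nonempty)).card < 2 ^ r) :
    ∃ C ∈ Z s t D, C ≠ 0 ∧ (supp C).card ≤ 2 * r := by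
  by_contra! hno
  have key : ∀ i, i ≤ r → ∃ (A B : Finset V) (T : Finset E) (p : V → E → F2),
      T ⊆ D ∧ A ⊆ B ∧ (∀ x ∈ A, (inc s t D x).Nonempty) ∧
      (∀ x ∈ B, (∀ e, e ∉ T → p x e = 0) ∧ (supp (p x)).card ≤ i ∧
        bd s t (p x) = Pi.single v0 1 + Pi.single x 1) ∧
      (∀ e ∈ T, s e ∈ B ∧ t e ∈ B) ∧
      (∀ x ∈ A, (inc s t T x).card ≤ 1) ∧ 2 ^ i ≤ A.card := by
    intro i
    induction i with
    | zero =>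
      intro _
      refine ⟨{v0}, {v0}, ∅, fun _ => 0, by simp, by simp, by simpa using hv0, ?_, by simp,
        by simp [inc], by simp⟩
      intro x hx
      rw [mem_singleton] at hx
      subst hx
      refine ⟨by simp, by simp [supp], ?_⟩
      rw [map_zero, F2_self]
    | succ i ih =>
      intro hi
      obtain ⟨A, B, T, p, hTD, hAB, hAN, hp, hTB, hA1, hAc⟩ := ih (by omega)
      have hsingle : ∀ e : E, bd s t (Pi.single e 1) = Pi.single (s e) 1 + Pi.single (t e) 1 := by
        intro e
        rw [bd_single, one_smul]
      have key1 : ∀ e ∈ D, e ∉ T → s e ∈ B → t e ∈ B → False := by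
        intro e he heT h1 h2
        obtain ⟨a1, a2, a3⟩ := hp _ h1
        obtain ⟨b1, b2, b3⟩ := hp _ h2
        have := hno (p (s e) + p (t e) + Pi.single e 1) ⟨?_, ?_⟩ ?_
        · have q1 := supp_add (p (s e) + p (t e)) (Pi.single e 1)
          have q2 := supp_add (p (s e)) (p (t e))
          have q3 := supp_single e
          omega
        · intro f hf
          have hfT : f ∉ T := fun h => hf (hTD h)
          have hfe : f ≠ e := fun h => hf (h ▸ he)
          simp [a1 f hfT, b1 f hfT, hfe]
        · rw [map_add, map_add, a3, b3, hsingle]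
          have : ∀ a b c : V → F2, a + b + (a + c) + (b + c) = 0 := by
            intro a b c
            calc a + b + (a + c) + (b + c) = (a + a) + (b + b) + (c + c) := by abel
              _ = 0 := by simp only [F2_self]
          exact this _ _ _
        · intro h
          have := congrFun h e
          simp [a1 e heT, b1 e heT] at this
      let S := (D \ T).filter (fun e => s e ∈ A ∨ t e ∈ A)
      let o : E → V := fun e => if s e ∈ A then t e else s e
      let n : E → V := fun e => if s e ∈ A then s e else t e
      have hSD : ∀ e ∈ S, e ∈ D ∧ e ∉ T := by
        intro e he
        simp only [S, mem_filter, mem_sdiff] at he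
        exact he.1
      have hnA : ∀ e ∈ S, n e ∈ A := by
        intro e he
        simp only [S, mem_filter] at he
        by_cases h : s e ∈ A
        · simp [n, h]
        · simp only [n, h, if_false]
          tauto
      have hno' : ∀ e, (s e = n e ∧ t e = o e) ∨ (s e = o e ∧ t e = n e) := by
        intro e
        by_cases h : s e ∈ A
        · simp [n, o, h]
        · simp [n, o, h]
      have hbS : ∀ e : E, bd s t (Pi.single e 1) = Pi.single (n e) 1 + Pi.single (o e) 1 := by
        intro e
        rw [hsingle]
        rcases hno' e with ⟨h1, h2⟩ | ⟨h1, h2⟩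
        · rw [h1, h2]
        · rw [h1, h2, add_comm]
      have hoB : ∀ e ∈ S, o e ∉ B := by
        intro e he ho
        have h1 := hAB (hnA e he)
        rcases hno' e with ⟨h2, h3⟩ | ⟨h2, h3⟩
        · exact key1 e (hSD e he).1 (hSD e he).2 (h2 ▸ h1) (h3 ▸ ho)
        · exact key1 e (hSD e he).1 (hSD e he).2 (h2 ▸ ho) (h3 ▸ h1)
      have hoinj : ∀ e ∈ S, ∀ f ∈ S, o e = o f → e = f := by
        intro e he f hf hef
        by_contra hne
        obtain ⟨a1, a2, a3⟩ := hp _ (hAB (hnA e he))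
        obtain ⟨b1, b2, b3⟩ := hp _ (hAB (hnA f hf))
        have := hno (p (n e) + p (n f) + (Pi.single e 1 + Pi.single f 1)) ⟨?_, ?_⟩ ?_
        · have q1 := supp_add (p (n e) + p (n f)) (Pi.single e 1 + Pi.single f 1)
          have q2 := supp_add (p (n e)) (p (n f))
          have q4 := supp_add (Pi.single e (1 : F2)) (Pi.single f 1)
          have q3 := supp_single e
          have q5 := supp_single f
          omega
        · intro g hg
          have hgT : g ∉ T := fun h => hg (hTD h)
          have hge : g ≠ e := fun h => hg (h ▸ (hSD e he).1)
          have hgf : g ≠ f := fun h => hg (h ▸ (hSD f hf).1)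
          simp [a1 g hgT, b1 g hgT, hge, hgf]
        · rw [map_add, map_add, map_add, a3, b3, hbS, hbS, hef]
          have : ∀ a b c d : V → F2, a + b + (a + c) + ((b + d) + (c + d)) = 0 := by
            intro a b c d
            calc a + b + (a + c) + ((b + d) + (c + d))
                = (a + a) + (b + b) + (c + c) + (d + d) := by abel
              _ = 0 := by simp only [F2_self]
          exact this _ _ _ _
        · intro h
          have := congrFun h e
          simp [a1 e (hSD e he).2, b1 e (hSD e he).2, hne] at this
      have hcard : A.card * 2 ≤ S.card := by
        rw [Finset.card_eq_sum_card_fiberwise (f := n) (t := A) (fun e he => hnA e he)]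
        rw [← smul_eq_mul]
        apply Finset.card_nsmul_le_sum
        intro x hx
        have h4 : inc s t D x \ inc s t T x ⊆ S.filter (fun e => n e = x) := by
          intro e he
          simp only [inc, mem_sdiff, mem_filter, not_and] at he
          obtain ⟨⟨he1, he2⟩, he3⟩ := he
          have heT : e ∉ T := fun h => he3 h he2
          have heS : e ∈ S := by
            simp only [S, mem_filter, mem_sdiff]
            refine ⟨⟨he1, heT⟩, ?_⟩
            rcases he2 with h | h
            · left; rwa [h]
            · right; rwa [h]
          rw [mem_filter]
          refine ⟨heS, ?_⟩
          have h5 := hoB e heS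
          have h6 := hAB hx
          rcases hno' e with ⟨h7, h8⟩ | ⟨h7, h8⟩ <;> rcases he2 with h9 | h9
          · rw [← h7, h9]
          · rw [← h8, h9] at h5; exact absurd h6 h5
          · rw [← h7, h9] at h5; exact absurd h6 h5
          · rw [← h8, h9]
        have h5 := card_le_card h4
        have h6 := Finset.le_card_sdiff (inc s t T x) (inc s t D x)
        have h7 := h3 x (hAN x hx)
        have h8 := hA1 x hx
        omega
      have hch : ∀ x, ∃ e, x ∈ S.image o → e ∈ S ∧ o e = x := by
        intro x
        by_cases h : x ∈ S.image o
        · obtain ⟨e, he⟩ := mem_image.1 h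
          exact ⟨e, fun _ => he⟩
        · obtain ⟨e, _⟩ := hv0
          exact ⟨e, fun h' => absurd h' h⟩
      choose ch hch using hch
      refine ⟨S.image o, B ∪ S.image o, T ∪ S,
        fun x => if x ∈ B then p x else p (n (ch x)) + Pi.single (ch x) 1, ?_, ?_, ?_, ?_, ?_, ?_, ?_⟩
      · intro e he
        rcases mem_union.1 he with h | h
        · exact hTD h
        · exact (hSD e h).1
      · exact subset_union_right
      · intro x hx
        obtain ⟨e, he, rfl⟩ := mem_image.1 hx
        refine ⟨e, ?_⟩
        simp only [inc, mem_filter]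
        refine ⟨(hSD e he).1, ?_⟩
        rcases hno' e with h | h
        · exact Or.inr h.2
        · exact Or.inl h.1
      · intro x hx
        by_cases hxB : x ∈ B
        · simp only [hxB, if_true]
          obtain ⟨a1, a2, a3⟩ := hp x hxB
          exact ⟨fun e he => a1 e (fun h => he (mem_union_left _ h)), by omega, a3⟩
        · simp only [hxB, if_false]
          have hx' : x ∈ S.image o := by
            rcases mem_union.1 hx with h | h
            · exact absurd h hxB
            · exact h
          obtain ⟨c1, c2⟩ := hch x hx'
          obtain ⟨a1, a2, a3⟩ := hp _ (hAB (hnA _ c1))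
          refine ⟨?_, ?_, ?_⟩
          · intro e he
            rw [mem_union, not_or] at he
            have : e ≠ ch x := fun h => he.2 (h ▸ c1)
            simp [a1 e he.1, this]
          · have q1 := supp_add (p (n (ch x))) (Pi.single (ch x) 1)
            have q2 := supp_single (ch x)
            omega
          · rw [map_add, a3, hbS, c2]
            have : ∀ a b c : V → F2, a + b + (b + c) = a + c := by
              intro a b c
              calc a + b + (b + c) = a + c + (b + b) := by abel
                _ = a + c := by rw [F2_self, add_zero]
            exact this _ _ _
      · intro e he
        rcases mem_union.1 he with h | h
        · exact ⟨mem_union_left _ (hTB e h).1, mem_union_left _ (hTB e h).2⟩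
        · have h1 : n e ∈ B ∪ S.image o := mem_union_left _ (hAB (hnA e h))
          have h2 : o e ∈ B ∪ S.image o := mem_union_right _ (mem_image_of_mem o h)
          rcases hno' e with ⟨h7, h8⟩ | ⟨h7, h8⟩
          · rw [h7, h8]; exact ⟨h1, h2⟩
          · rw [h7, h8]; exact ⟨h2, h1⟩
      · intro x hx
        have hxB : x ∉ B := by
          obtain ⟨e, he, rfl⟩ := mem_image.1 hx
          exact hoB e he
        have aux : ∀ e ∈ inc s t (T ∪ S) x, e ∈ S ∧ o e = x := by
          intro e he
          simp only [inc, mem_filter, mem_union] at he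
          obtain ⟨h1 | h1, h2⟩ := he
          · exfalso
            rcases h2 with h2 | h2
            · exact hxB (h2 ▸ (hTB e h1).1)
            · exact hxB (h2 ▸ (hTB e h1).2)
          · refine ⟨h1, ?_⟩
            have h5 := hAB (hnA e h1)
            rcases hno' e with ⟨h7, h8⟩ | ⟨h7, h8⟩ <;> rcases h2 with h9 | h9
            · rw [← h7, h9] at h5; exact absurd h5 hxB
            · rw [← h8, h9]
            · rw [← h7, h9]
            · rw [← h8, h9] at h5; exact absurd h5 hxB
        rw [Finset.card_le_one]
        intro a ha b hb
        exact hoinj a (aux a ha).1 b (aux b hb).1 ((aux a ha).2.trans (aux b hb).2.symm)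
      · rw [Finset.card_image_of_injOn (fun e he f hf h => hoinj e he f hf h), pow_succ]
        omega
  obtain ⟨A, B, T, p, -, -, hAN, -, -, -, hAc⟩ := key r le_rfl
  have : A ⊆ univ.filter (fun v => (inc s t D v).Nonempty) := by
    intro x hx
    simpa using hAN x hx
  have := card_le_card this
  omega

lemma bd_inc (s t : E → V) (D : Finset E) (hl : ∀ e ∈ D, s e ≠ t e) (x : E → F2)
    (hx : ∀ e, e ∉ D → x e = 0) (v : V) : bd s t x v = ∑ e ∈ inc s t D v, x e := by
  rw [bd_apply, inc, Finset.sum_filter, ← Finset.sum_subset (Finset.subset_univ D)]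
  · apply Finset.sum_congr rfl
    intro e he
    have := hl e he
    by_cases h1 : s e = v
    · have h2 : t e ≠ v := fun h => this (h1.trans h.symm)
      simp [h1, h2]
    · simp [h1]
  · intro e _ he
    simp [hx e he]

lemma deg_sum (s t : E → V) (D : Finset E) : ∑ v, (inc s t D v).card ≤ 2 * D.card := by
  simp only [inc, Finset.card_filter]
  rw [Finset.sum_comm, mul_comm, ← smul_eq_mul]
  apply Finset.sum_le_card_nsmul
  intro e _
  rw [← Finset.card_filter]
  have : univ.filter (fun v => s e = v ∨ t e = v) ⊆ {s e, t e} := by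
    intro v
    simp only [mem_filter, mem_univ, true_and, mem_insert, mem_singleton]
    tauto
  exact (card_le_card this).trans card_le_two

/-- pushforward of vertex vectors -/
noncomputable def push (π : V → V) : (V → F2) →ₗ[F2] (V → F2) :=
  Fintype.linearCombination F2 (fun u => Pi.single (π u) (1 : F2))

lemma push_single (π : V → V) (u : V) : push π (Pi.single u 1) = Pi.single (π u) 1 := by
  simp [push, Fintype.linearCombination_apply_single]

lemma push_bd (π : V → V) (s t : E → V) (x : E → F2) :
    push π (bd s t x) = bd (π ∘ s) (π ∘ t) x := by
  simp only [bd, Fintype.linearCombination_apply, map_sum, map_smul, map_add, push_single,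
    Function.comp]

lemma push_apply (π : V → V) (b : V → F2) (u : V) :
    push π b u = ∑ v ∈ univ.filter (fun v => π v = u), b v := by
  simp [push, Fintype.linearCombination_apply, Finset.sum_apply, Pi.single_apply, eq_comm,
    Finset.sum_filter]

/-- lift after contraction of `f` in series with `e` -/
noncomputable def lft (e f : E) : (E → F2) →ₗ[F2] (E → F2) :=
  LinearMap.id + (LinearMap.single F2 (fun _ : E => F2) f).comp (LinearMap.proj e)

lemma lft_apply (e f : E) (y : E → F2) : lft e f y = y + Pi.single f (y e) := by
  simp [lft]

lemma lft_inj (e f : E) (hef : e ≠ f) : Function.Injective (lft e f) := by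
  rw [← LinearMap.ker_eq_bot, LinearMap.ker_eq_bot']
  intro y hy
  rw [lft_apply] at hy
  have h1 := congrFun hy e
  simp [hef] at h1
  simpa [h1] using hy

lemma lft_mem (s t : E → V) (D : Finset E) (hl : ∀ e ∈ D, s e ≠ t e) (v w : V) (hvw : v ≠ w)
    (e f : E) (hef : e ≠ f) (hinc : inc s t D v = {e, f})
    (hf : (s f = v ∧ t f = w) ∨ (s f = w ∧ t f = v)) (y : E → F2)
    (hy : y ∈ Z ((fun u => if u = v then w else u) ∘ s) ((fun u => if u = v then w else u) ∘ t)
      (D.erase f)) : lft e f y ∈ Z s t D := by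
  have hfD : f ∈ D := by
    have : f ∈ inc s t D v := by simp [hinc]
    simp only [inc, mem_filter] at this
    exact this.1
  have hyD : ∀ g, g ∉ D → y g = 0 := fun g hg => hy.1 g (fun h => hg (mem_of_mem_erase h))
  have hyf : y f = 0 := hy.1 f (by simp)
  have hv : bd s t y v = y e := by
    rw [bd_inc s t D hl y hyD v, hinc, Finset.sum_pair hef, hyf, add_zero]
  have hpush := hy.2
  rw [← push_bd] at hpush
  rw [lft_apply]
  refine ⟨?_, ?_⟩
  · intro g hg
    have : g ≠ f := fun h => hg (h ▸ hfD)
    simp [hyD g hg, this]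
  · rw [map_add, bd_single]
    have hs : (Pi.single (s f) (1 : F2) + Pi.single (t f) 1 : V → F2)
        = Pi.single v 1 + Pi.single w 1 := by
      rcases hf with ⟨h1, h2⟩ | ⟨h1, h2⟩
      · rw [h1, h2]
      · rw [h1, h2, add_comm]
    rw [hs]
    have hw : bd s t y w = y e := by
      have h1 := congrFun hpush w
      rw [push_apply] at h1
      have h2 : univ.filter (fun u => (if u = v then w else u) = w) = {v, w} := by
        ext u
        by_cases h : u = v <;> simp [h]
      rw [h2, Finset.sum_pair hvw, hv] at h1
      have : ∀ a b : F2, a + b = 0 → b = a := by decide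
      exact this _ _ h1
    ext u
    by_cases huv : u = v
    · subst huv
      simp [hv, hvw, F2_self]
    · by_cases huw : u = w
      · subst huw
        simp [hw, huv, F2_self]
      · have h1 := congrFun hpush u
        rw [push_apply] at h1
        have h2 : univ.filter (fun u' => (if u' = v then w else u') = u) = {u} := by
          ext u'
          by_cases h : u' = v
          · simp [h, Ne.symm huw, Ne.symm huv]
          · simp [h]
        rw [h2, Finset.sum_singleton] at h1
        simp [h1, huv, huw]

lemma short (m : ℕ) : ∀ (s t : E → V) (D : Finset E) (r : ℕ), D.card = m →
    1 ≤ finrank F2 (Z s t D) → 2 * finrank F2 (Z s t D) < 2 ^ r →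
    ∃ C ∈ Z s t D, C ≠ 0 ∧
      finrank F2 (Z s t D) ≤ finrank F2 (Z s t (D \ supp C)) + 2 * r := by
  induction m using Nat.strong_induction_on with
  | _ m ih =>
  intro s t D r hm h1 hr
  have hr1 : 1 ≤ r := by
    by_contra h
    have : r = 0 := by omega
    subst this
    omega
  have fin : ∀ C ∈ Z s t D, C ≠ 0 → (supp C).card ≤ 2 * r → ∃ C ∈ Z s t D, C ≠ 0 ∧
      finrank F2 (Z s t D) ≤ finrank F2 (Z s t (D \ supp C)) + 2 * r := by
    intro C hC hC0 hc
    have := Z_del s t D (supp C)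
    exact ⟨C, hC, hC0, by omega⟩
  by_cases hl : ∀ e ∈ D, s e ≠ t e
  swap
  · push Not at hl
    obtain ⟨e, he, hst⟩ := hl
    apply fin (Pi.single e 1)
    · refine ⟨?_, ?_⟩
      · intro f hf
        have : f ≠ e := fun h => hf (h ▸ he)
        simp [this]
      · rw [bd_single, hst, F2_self, smul_zero]
    · simp
    · have := supp_single e
      omega
  by_cases h3 : ∀ v, (inc s t D v).Nonempty → 3 ≤ (inc s t D v).card
  · have hne : ∃ v0, (inc s t D v0).Nonempty := by
      have : D.Nonempty := by
        by_contra h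
        rw [Finset.not_nonempty_iff_eq_empty] at h
        subst h
        have hb : Z s t (∅ : Finset E) = ⊥ := by
          rw [eq_bot_iff]
          intro x hx
          rw [Submodule.mem_bot]
          ext e
          exact hx.1 e (by simp)
        rw [hb, finrank_bot] at h1
        omega
      obtain ⟨e, he⟩ := this
      exact ⟨s e, e, by simp [inc, he]⟩
    obtain ⟨v0, hv0⟩ := hne
    obtain ⟨C, hC, hC0, hc⟩ := moore s t D h3 v0 hv0 r (by
      have a1 := Z_lower s t D
      have a2 := deg_sum s t D
      have a3 : (univ.filter (fun v => (inc s t D v).Nonempty)).card * 3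
          ≤ ∑ v, (inc s t D v).card := by
        rw [← smul_eq_mul]
        refine le_trans (Finset.card_nsmul_le_sum _ (fun v => (inc s t D v).card) 3 ?_)
          (Finset.sum_le_sum_of_subset (Finset.filter_subset _ _))
        intro v hv
        exact h3 v (by simpa using hv)
      omega)
    exact fin C hC hC0 hc
  push Not at h3
  obtain ⟨v, hv, hv3⟩ := h3
  have hv1 := hv.card_pos
  have hcase : (inc s t D v).card = 1 ∨ (inc s t D v).card = 2 := by omega
  rcases hcase with hc | hc
  · obtain ⟨e, he⟩ := Finset.card_eq_one.1 hc
    have heD : e ∈ D := by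
      have : e ∈ inc s t D v := by simp [he]
      simp only [inc, mem_filter] at this
      exact this.1
    have hZ : Z s t (D.erase e) = Z s t D := by
      apply le_antisymm (Z_mono s t (Finset.erase_subset _ _))
      intro x hx
      refine ⟨?_, hx.2⟩
      intro f hf
      by_cases hfe : f = e
      · subst hfe
        have := bd_inc s t D hl x hx.1 v
        rw [he, Finset.sum_singleton, hx.2] at this
        exact this.symm
      · exact hx.1 f (fun h => hf (mem_erase.2 ⟨hfe, h⟩))
    have := card_erase_lt_of_mem heD
    obtain ⟨C, hC, hC0, hd⟩ := ih _ (by omega) s t (D.erase e) r rfl (by rw [hZ]; exact h1)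
      (by rw [hZ]; exact hr)
    rw [hZ] at hC hd
    refine ⟨C, hC, hC0, hd.trans ?_⟩
    have := Submodule.finrank_mono
      (Z_mono s t (sdiff_subset_sdiff (erase_subset e D) (subset_refl (supp C))))
    omega
  · obtain ⟨e, f, hef, he⟩ := Finset.card_eq_two.1 hc
    have hfi : f ∈ inc s t D v := by simp [he]
    simp only [inc, mem_filter] at hfi
    obtain ⟨hfD, hfv⟩ := hfi
    have hw : ∃ w, v ≠ w ∧ ((s f = v ∧ t f = w) ∨ (s f = w ∧ t f = v)) := by
      have := hl f hfD
      rcases hfv with h | h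
      · exact ⟨t f, fun h' => this (h.trans h'), Or.inl ⟨h, rfl⟩⟩
      · exact ⟨s f, fun h' => this (h'.symm.trans h.symm), Or.inr ⟨rfl, h⟩⟩
    obtain ⟨w, hvw, hf⟩ := hw
    have hmem := lft_mem s t D hl v w hvw e f hef he hf
    obtain ⟨π, hπ⟩ : ∃ π : V → V, π = (fun u => if u = v then w else u) := ⟨_, rfl⟩
    rw [← hπ] at hmem
    have hle : finrank F2 (Z (π ∘ s) (π ∘ t) (D.erase f)) ≤ finrank F2 (Z s t D) := by
      rw [(Submodule.equivMapOfInjective _ (lft_inj e f hef) _).finrank_eq]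
      apply Submodule.finrank_mono
      rintro _ ⟨y, hy, rfl⟩
      exact hmem y hy
    have hge : finrank F2 (Z s t D) ≤ finrank F2 (Z (π ∘ s) (π ∘ t) (D.erase f)) := by
      rw [(Submodule.equivMapOfInjective _ (lft_inj e f hef)
        (Z (π ∘ s) (π ∘ t) (D.erase f))).finrank_eq]
      apply Submodule.finrank_mono
      intro x hx
      have hxef : x e = x f := by
        have := bd_inc s t D hl x hx.1 v
        rw [he, Finset.sum_pair hef, hx.2] at this
        have q : ∀ a b : F2, 0 = a + b → a = b := by decide
        exact q _ _ this
      refine ⟨x + Pi.single f (x f), ⟨?_, ?_⟩, ?_⟩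
      · intro g hg
        by_cases hgf : g = f
        · subst hgf
          simp [F2_self]
        · have : g ∉ D := fun h => hg (mem_erase.2 ⟨hgf, h⟩)
          simp [hx.1 g this, hgf]
      · rw [← push_bd, map_add, hx.2, zero_add, bd_single, map_smul, map_add, push_single,
          push_single]
        have : π (s f) = w ∧ π (t f) = w := by
          subst hπ
          rcases hf with ⟨a, b⟩ | ⟨a, b⟩ <;> simp [a, b]
        rw [this.1, this.2, F2_self, smul_zero]
      · rw [lft_apply]
        simp [hef, hxef, add_assoc, F2_self]
    have := card_erase_lt_of_mem hfD
    obtain ⟨C, hC, hC0, hd⟩ := ih _ (by omega) (π ∘ s) (π ∘ t) (D.erase f) r rfl (by omega)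
      (by omega)
    refine ⟨lft e f C, hmem C hC, ?_, ?_⟩
    · intro h
      exact hC0 (lft_inj e f hef (h.trans (map_zero _).symm))
    · have : finrank F2 (Z (π ∘ s) (π ∘ t) (D.erase f \ supp C))
          ≤ finrank F2 (Z s t (D \ supp (lft e f C))) := by
        rw [(Submodule.equivMapOfInjective _ (lft_inj e f hef) _).finrank_eq]
        apply Submodule.finrank_mono
        rintro _ ⟨y, hy, rfl⟩
        have hy' := hmem y (Z_mono _ _ sdiff_subset hy)
        refine ⟨?_, hy'.2⟩
        intro g hg
        by_cases hgD : g ∈ D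
        · have hgC : lft e f C g ≠ 0 := by
            by_contra h
            exact hg (by simp [hgD, mem_supp, h])
          by_cases hgf : g = f
          · subst hgf
            have hCg : C g = 0 := hC.1 g (by simp)
            rw [lft_apply] at hgC ⊢
            simp [hCg] at hgC
            have h1 : y e = 0 := hy.1 e (by simp [mem_supp, hgC])
            have h2 : y g = 0 := hy.1 g (by simp)
            simp [h1, h2]
          · rw [lft_apply] at hgC ⊢
            simp [hgf] at hgC ⊢
            exact hy.1 g (by simp [mem_supp, hgC])
        · exact hy'.1 g hgD
      omega

lemma shrink (s t : E → V) (n : ℕ) (D : Finset E) (h : n ≤ finrank F2 (Z s t D)) :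
    ∃ D' ⊆ D, finrank F2 (Z s t D') = n := by
  induction D using Finset.induction_on with
  | empty =>
    refine ⟨∅, subset_refl _, ?_⟩
    have hb : Z s t (∅ : Finset E) = ⊥ := by
      rw [eq_bot_iff]
      intro x hx
      rw [Submodule.mem_bot]
      ext e
      exact hx.1 e (by simp)
    rw [hb, finrank_bot] at h ⊢
    omega
  | insert a D ha ih =>
    by_cases h1 : n ≤ finrank F2 (Z s t D)
    · obtain ⟨D', h2, h3⟩ := ih h1
      exact ⟨D', h2.trans (subset_insert _ _), h3⟩
    · refine ⟨insert a D, subset_refl _, ?_⟩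
      have := Z_del s t (insert a D) {a}
      have h2 : insert a D \ {a} = D := by
        rw [sdiff_singleton_eq_erase, erase_insert ha]
      rw [h2, card_singleton] at this
      omega

lemma pack (s t : E → V) (r k : ℕ) : ∀ D : Finset E,
    2 * finrank F2 (Z s t D) < 2 ^ r → k * (2 * r) + 1 ≤ finrank F2 (Z s t D) →
    ∃ cs : Fin (k + 1) → (E → F2), (∀ i, cs i ∈ Z s t D ∧ cs i ≠ 0) ∧
      ∀ i j, i ≠ j → ∀ e, cs i e ≠ 0 → cs j e = 0 := by
  induction k with
  | zero =>
    intro D hr h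
    obtain ⟨C, hC, hC0, -⟩ := short _ s t D r rfl (by omega) hr
    refine ⟨fun _ => C, fun _ => ⟨hC, hC0⟩, ?_⟩
    intro i j hij
    exact absurd (Subsingleton.elim (α := Fin 1) i j) hij
  | succ k ih =>
    intro D hr h
    obtain ⟨C, hC, hC0, hd⟩ := short _ s t D r rfl (by omega) hr
    have hm := Submodule.finrank_mono (Z_mono s t (sdiff_subset : D \ supp C ⊆ D))
    have : (k + 1) * (2 * r) = k * (2 * r) + 2 * r := by ring
    obtain ⟨cs, h1, h2⟩ := ih (D \ supp C) (by omega) (by omega)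
    have hdis : ∀ i e, C e ≠ 0 → cs i e = 0 := fun i e he =>
      (h1 i).1.1 e (by simp [mem_supp, he])
    refine ⟨Fin.cons C cs, ?_, ?_⟩
    · intro i
      refine Fin.cases ⟨hC, hC0⟩ (fun i => ?_) i
      exact ⟨Z_mono s t sdiff_subset (h1 i).1, (h1 i).2⟩
    · intro i j
      refine Fin.cases ?_ (fun i => ?_) i <;> refine Fin.cases ?_ (fun j => ?_) j
      · intro h; exact absurd rfl h
      · intro _ e he
        exact hdis j e he
      · intro _ e he
        by_contra hc
        exact he (hdis i e hc)
      · intro hij e he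
        exact h2 i j (fun h => hij (by rw [h])) e he

lemma arith (L k : ℕ) (hL : 1 ≤ L) (hk : k + 1 ≤ 2 ^ L) :
    2 * (k * (2 * (4 * L + 1)) + 1) < 2 ^ (4 * L + 1) := by
  have h1 : (2 : ℕ) ^ (4 * L + 1) = 2 * (2 ^ L * 8 ^ L) := by
    rw [← Nat.mul_pow, pow_succ, pow_mul]; norm_num; ring
  rw [h1]
  rcases hL.eq_or_lt with rfl | hL
  · norm_num at *; omega
  · have h8 : 8 * L + 2 ≤ 8 ^ L := by
      clear h1 hk
      induction L, hL using Nat.le_induction with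
      | base => norm_num
      | succ n hn ih => rw [pow_succ]; omega
    have := Nat.mul_le_mul hk h8
    nlinarith

/-- first endpoint -/
noncomputable def es (e : Sym2 V) : V := (Quot.out e).1
/-- second endpoint -/
noncomputable def et (e : Sym2 V) : V := (Quot.out e).2

lemma mk_es_et (e : Sym2 V) : s(es e, et e) = e := Quot.out_eq e

/-- cycle space of a set of unordered pairs -/
noncomputable abbrev ZG (D : Finset (Sym2 V)) : Submodule F2 (Sym2 V → F2) :=
  Z (E := Sym2 V) es et D

lemma bdG_single (u v : V) : bd (E := Sym2 V) es et (Pi.single s(u, v) 1)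
    = Pi.single u 1 + Pi.single v 1 := by
  rw [bd_single, one_smul]
  have := mk_es_et s(u, v)
  rw [Sym2.eq_iff] at this
  rcases this with ⟨h1, h2⟩ | ⟨h1, h2⟩
  · rw [h1, h2]
  · rw [h1, h2, add_comm]

lemma exists_cycle (G : SimpleGraph V) (D : Finset (Sym2 V)) (hD : ∀ e ∈ D, e ∈ G.edgeSet)
    (x : Sym2 V → F2) (hx : x ∈ ZG D) (hx0 : x ≠ 0) :
    ∃ (v : V) (w : G.Walk v v), w.IsCycle ∧ ∀ e ∈ w.edges, x e ≠ 0 := by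
  classical
  let H := G.deleteEdges {e | x e = 0}
  have hHG : H ≤ G := G.deleteEdges_le _
  by_cases hH : H.IsAcyclic
  swap
  · unfold SimpleGraph.IsAcyclic at hH
    push Not at hH
    obtain ⟨v, c, hc⟩ := hH
    refine ⟨v, c.mapLe hHG, hc.mapLe hHG, ?_⟩
    intro e he
    rw [SimpleGraph.Walk.edges_mapLe_eq_edges] at he
    have := c.edges_subset_edgeSet he
    rw [SimpleGraph.edgeSet_deleteEdges] at this
    exact this.2
  exfalso
  have hHe : ∀ e, x e ≠ 0 → e ∈ H.edgeSet := by
    intro e he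
    rw [SimpleGraph.edgeSet_deleteEdges]
    refine ⟨hD e ?_, he⟩
    by_contra h
    exact he (hx.1 e h)
  obtain ⟨e, he⟩ := Function.ne_iff.1 hx0
  simp only [Pi.zero_apply] at he
  have hb := SimpleGraph.isAcyclic_iff_forall_isBridge.1 hH
  have hbe : ¬ (H.deleteEdges {e}).Reachable (es e) (et e) := by
    have : H.IsBridge s(es e, et e) := by
      exact hb (by rw [mk_es_et]; exact hHe e he)
    rw [SimpleGraph.isBridge_iff, mk_es_et] at this
    exact this
  let R := univ.filter (fun w => (H.deleteEdges {e}).Reachable (es e) w)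
  have h0 : ∑ w ∈ R, bd (E := Sym2 V) es et x w = 0 := by
    rw [hx.2]; simp
  simp only [bd_apply] at h0
  rw [Finset.sum_comm, Finset.sum_eq_single e] at h0
  · have h1 : es e ∈ R := by simp [R]
    have h2 : et e ∉ R := by simpa [R] using hbe
    simp [← Finset.mul_sum, Finset.sum_add_distrib, h1, h2] at h0
    exact he h0
  · intro f _ hfe
    by_cases hf : x f = 0
    · simp [hf]
    · have hadj : (H.deleteEdges {e}).Adj (es f) (et f) := by
        rw [← SimpleGraph.mem_edgeSet, mk_es_et, SimpleGraph.edgeSet_deleteEdges]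
        exact ⟨hHe f hf, hfe⟩
      have hiff : es f ∈ R ↔ et f ∈ R := by
        simp only [R, mem_filter, mem_univ, true_and]
        exact ⟨fun h => h.trans hadj.reachable, fun h => h.trans hadj.symm.reachable⟩
      by_cases h1 : es f ∈ R
      · have h2 := hiff.1 h1
        simp [← Finset.mul_sum, Finset.sum_add_distrib, h1, h2, F2_self]
      · have h2 : et f ∉ R := fun h => h1 (hiff.2 h)
        simp [← Finset.mul_sum, Finset.sum_add_distrib, h1, h2]
  · simp

lemma walk_vec (H : SimpleGraph V) {u v : V} (w : H.Walk u v) :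
    ∃ x : Sym2 V → F2, (∀ e, e ∉ w.edges → x e = 0) ∧
      bd (E := Sym2 V) es et x = Pi.single u 1 + Pi.single v 1 := by
  induction w with
  | nil => exact ⟨0, by simp, by rw [map_zero, F2_self]⟩
  | @cons a b c h p ih =>
    obtain ⟨x, h1, h2⟩ := ih
    refine ⟨Pi.single s(a, b) 1 + x, ?_, ?_⟩
    · intro e he
      simp only [SimpleGraph.Walk.edges_cons, List.mem_cons, not_or] at he
      simp [h1 e he.2, he.1]
    · rw [map_add, bdG_single, h2]
      have : ∀ a b c : V → F2, a + b + (b + c) = a + c := by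
        intro a b c
        calc a + b + (b + c) = a + c + (b + b) := by abel
          _ = a + c := by rw [F2_self, add_zero]
      exact this _ _ _

lemma hit (G : SimpleGraph V) (n : ℕ) : ∀ F0 : Finset (Sym2 V),
    ∀ D : Finset (Sym2 V), D.card = n → (∀ e, e ∈ D ↔ e ∈ (G.deleteEdges ↑F0).edgeSet) →
    ∃ F : Finset (Sym2 V), F ⊆ D ∧ F.card ≤ finrank F2 (ZG D) ∧
      (G.deleteEdges (↑(F0 ∪ F) : Set (Sym2 V))).IsAcyclic := by
  induction n with
  | zero =>
    intro F0 D hc hD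
    refine ⟨∅, by simp, by simp, ?_⟩
    rw [Finset.card_eq_zero] at hc
    subst hc
    rw [Finset.union_empty, SimpleGraph.isAcyclic_iff_forall_isBridge]
    intro e he
    exact absurd ((hD _).2 he) (by simp)
  | succ n ih =>
    intro F0 D hc hD
    by_cases hac : (G.deleteEdges (↑F0 : Set (Sym2 V))).IsAcyclic
    · exact ⟨∅, by simp, by simp, by simpa using hac⟩
    rw [SimpleGraph.isAcyclic_iff_forall_isBridge] at hac
    push Not at hac
    obtain ⟨e, he, hbr⟩ := hac
    induction e using Sym2.ind with
    | _ u v =>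
    rw [SimpleGraph.isBridge_iff_forall_walk_mem_edges] at hbr
    push Not at hbr
    obtain ⟨p, hp⟩ := hbr
    obtain ⟨x, hx1, hx2⟩ := walk_vec _ p
    have heD : s(u, v) ∈ D := (hD _).2 he
    have hy : x + Pi.single s(u, v) 1 ∈ ZG D := by
      refine ⟨?_, ?_⟩
      · intro f hf
        have h1 : f ∉ p.edges := fun h => hf ((hD _).2 (p.edges_subset_edgeSet h))
        have h2 : f ≠ s(u, v) := fun h => hf (h ▸ heD)
        simp [hx1 f h1, h2]
      · rw [map_add, hx2, bdG_single, F2_self]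
    have hlt : finrank F2 (ZG (D.erase s(u, v))) < finrank F2 (ZG D) := by
      apply Submodule.finrank_lt_finrank_of_lt
      refine lt_of_le_of_ne (Z_mono _ _ (erase_subset _ _)) ?_
      intro h
      have hy2 : x + Pi.single s(u, v) 1 ∈ ZG (D.erase s(u, v)) := by
        rw [show ZG (D.erase s(u, v)) = ZG D from h]; exact hy
      have := hy2.1 s(u, v) (by simp)
      simp [hx1 _ hp] at this
    obtain ⟨F, hF1, hF2, hF3⟩ := ih (insert s(u, v) F0) (D.erase s(u, v))
      (by rw [card_erase_of_mem heD, hc]; rfl) (by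
        intro f
        rw [mem_erase, hD, SimpleGraph.edgeSet_deleteEdges, SimpleGraph.edgeSet_deleteEdges]
        simp only [Set.mem_sdiff, coe_insert, Set.mem_insert_iff]
        tauto)
    refine ⟨insert s(u, v) F, ?_, ?_, ?_⟩
    · exact insert_subset heD (hF1.trans (erase_subset _ _))
    · have := card_insert_le s(u, v) F
      omega
    · rwa [Finset.union_insert, ← Finset.insert_union]

end
end EP

/-- **Erdős–Pósa theorem (edge version).** Every finite graph either contains `k`
pairwise edge-disjoint cycles, or a set `F` of at most `k(8⌈log₂ k⌉ + 2)` edges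
such that `G - F` has no cycle. -/
theorem erdos_posa_edge {V : Type*} [Fintype V] (G : SimpleGraph V) (k : ℕ) :
    (∃ cs : Fin k → Σ v : V, G.Walk v v,
      (∀ i, (cs i).2.IsCycle) ∧
      (∀ i j, i ≠ j → ∀ e ∈ (cs i).2.edges, e ∉ (cs j).2.edges)) ∨
    (∃ F : Finset (Sym2 V), ↑F ⊆ G.edgeSet ∧ F.card ≤ k * (8 * Nat.clog 2 k + 2) ∧
      ∀ (v : V) (w : (G.deleteEdges ↑F).Walk v v), ¬ w.IsCycle) := by
  classical
  obtain ⟨F, hF1, hF2, hF3⟩ := EP.hit G _ ∅ G.edgeFinset rfl (by intro e; simp)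
  rw [Finset.empty_union] at hF3
  by_cases hle : F.card ≤ k * (8 * Nat.clog 2 k + 2)
  · right
    refine ⟨F, ?_, hle, fun v w => hF3 w⟩
    intro e he
    simpa using hF1 he
  left
  have hpack : ∃ cs : Fin k → (Sym2 V → EP.F2), (∀ i, cs i ∈ EP.ZG G.edgeFinset ∧ cs i ≠ 0) ∧
      ∀ i j, i ≠ j → ∀ e, cs i e ≠ 0 → cs j e = 0 := by
    have aux : ∀ r k : ℕ, 2 * (k * (2 * r) + 1) < 2 ^ r →
        k * (2 * r) + 1 ≤ Module.finrank EP.F2 (EP.ZG G.edgeFinset) →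
        ∃ cs : Fin (k + 1) → (Sym2 V → EP.F2), (∀ i, cs i ∈ EP.ZG G.edgeFinset ∧ cs i ≠ 0) ∧
          ∀ i j, i ≠ j → ∀ e, cs i e ≠ 0 → cs j e = 0 := by
      intro r k h1 h2
      obtain ⟨D', hD', hd⟩ := EP.shrink EP.es EP.et _ _ h2
      obtain ⟨cs, h3, h4⟩ := EP.pack EP.es EP.et r k D' (by rw [hd]; exact h1) (by rw [hd])
      exact ⟨cs, fun i => ⟨EP.Z_mono _ _ hD' (h3 i).1, (h3 i).2⟩, h4⟩
    match k, hle with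
    | 0, _ => exact ⟨fun i => i.elim0, fun i => i.elim0, fun i => i.elim0⟩
    | 1, hle => exact aux 2 0 (by norm_num) (by omega)
    | (k + 2), hle =>
      have hL : 1 ≤ Nat.clog 2 (k + 2) := Nat.clog_pos (by norm_num) (by omega)
      have hk : k + 1 + 1 ≤ 2 ^ Nat.clog 2 (k + 2) := Nat.le_pow_clog (by norm_num) _
      refine aux _ (k + 1) (EP.arith _ (k + 1) hL hk) ?_
      have : (k + 2) * (8 * Nat.clog 2 (k + 2) + 2) = (k + 1) * (2 * (4 * Nat.clog 2 (k + 2) + 1))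
        + (8 * Nat.clog 2 (k + 2) + 2) := by ring
      omega
  obtain ⟨cs, h1, h2⟩ := hpack
  have h3 : ∀ i, ∃ c : Σ v : V, G.Walk v v, c.2.IsCycle ∧ ∀ e ∈ c.2.edges, cs i e ≠ 0 := by
    intro i
    obtain ⟨v, w, hw⟩ := EP.exists_cycle G G.edgeFinset (by intro e; simp) (cs i) (h1 i).1 (h1 i).2
    exact ⟨⟨v, w⟩, hw⟩
  choose c hc1 hc2 using h3
  exact ⟨c, hc1, fun i j hij e he he' => hc2 j e he' (h2 i j hij e (hc2 i e he))⟩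
end

section
/- Let ℓ be a positive integer and let g be a positive integer with g ≥ 2ℓ − 1. Let G be a finite connected graph of diameter strictly less than g/2 such that every cycle of G has length < ℓ or length > g. Then every cycle of G has length < ℓ. -/
namespace ShortCycles

open SimpleGraph Walk

lemma cycle_swap {V : Type*} {G : SimpleGraph V} {x y : V} (A : G.Walk x y) (B : G.Walk y x)
    (hA : 0 < A.length) (hB : 0 < B.length) (h : (A.append B).IsCycle) :
    (B.append A).IsCycle := by
  have hl := h.three_le_length
  rw [length_append] at hl
  have nA : ¬ A.Nil := by rw [← length_eq_zero_iff]; omega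
  have nB : ¬ B.Nil := by rw [← length_eq_zero_iff]; omega
  have hd := h.support_nodup
  rw [tail_support_append, List.nodup_append'] at hd
  exact (h.isPath_of_append_right nA).isCycle_append (h.isPath_of_append_left nB) hd.2.2.symm
    (by omega)

/-- A split of a cycle of length `L` into two arcs, both longer than the distance. -/
def Split {V : Type*} (G : SimpleGraph V) (L : ℕ) {x y : V} (A : G.Walk x y) (B : G.Walk y x) :
    Prop :=
  (A.append B).IsCycle ∧ A.length + B.length = L ∧ G.dist x y < A.length ∧ G.dist x y < B.length

lemma Split.swap {V : Type*} {G : SimpleGraph V} {L : ℕ} {x y : V} {A : G.Walk x y}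
    {B : G.Walk y x} (h : Split G L A B) : Split G L B A := by
  obtain ⟨h1, h2, h3, h4⟩ := h
  refine ⟨cycle_swap A B (by omega) (by omega) h1, by omega, ?_, ?_⟩ <;> rw [dist_comm] <;> assumption

lemma cycle_of_min {V : Type*} {G : SimpleGraph V} {L : ℕ} {x y : V} {A : G.Walk x y}
    {B : G.Walk y x} (h : Split G L A B)
    (hmin : ∀ (x' y' : V) (A' : G.Walk x' y') (B' : G.Walk y' x'), Split G L A' B' →
      G.dist x y ≤ G.dist x' y')
    (P : G.Walk x y) (hP : P.length = G.dist x y) : (A.append P.reverse).IsCycle := by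
  classical
  obtain ⟨h1, h2, h3, h4⟩ := h
  have hPp := P.isPath_of_length_eq_dist hP
  have nB : ¬ B.Nil := by rw [← length_eq_zero_iff]; omega
  have hAp := h1.isPath_of_append_left nB
  have key : ∀ z, z ∈ A.support → z ∈ P.support → z = x ∨ z = y := by
    intro z hzA hzP
    by_contra! hz
    have e1 := P.take_spec hzP
    have e2 := congrArg Walk.length e1
    rw [length_append] at e2
    have d1 := dist_le (P.takeUntil z hzP)
    have d2 := dist_le (P.dropUntil z hzP)
    have e3 := A.take_spec hzA
    generalize A.takeUntil z hzA = A1 at *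
    generalize A.dropUntil z hzA = A2 at *
    generalize P.takeUntil z hzP = P1 at *
    generalize P.dropUntil z hzP = P2 at *
    have p1 : 0 < P1.length := by
      by_contra! hc
      exact hz.1 (eq_of_length_eq_zero (p := P1) (by omega)).symm
    have p2 : 0 < P2.length := by
      by_contra! hc
      exact hz.2 (eq_of_length_eq_zero (p := P2) (by omega))
    have p3 : 0 < A1.length := by
      by_contra! hc
      exact hz.1 (eq_of_length_eq_zero (p := A1) (by omega)).symm
    have p4 : 0 < A2.length := by
      by_contra! hc
      exact hz.2 (eq_of_length_eq_zero (p := A2) (by omega))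
    subst e3
    rw [length_append] at h2 h3
    rw [← append_assoc] at h1
    have c2 := cycle_swap _ _ p3 (by rw [length_append]; omega) h1
    rw [← append_assoc] at c2
    by_cases q1 : G.dist x z < A1.length
    · have := hmin x z A1 (A2.append B) ⟨h1, by rw [length_append]; omega, q1,
        by rw [length_append]; omega⟩
      omega
    by_cases q2 : G.dist z y < A2.length
    · have := hmin z y A2 (B.append A1) ⟨c2, by rw [length_append]; omega, q2,
        by rw [length_append]; omega⟩
      omega
    omega
  have n1 := hAp.support_nodup
  have n2 := hPp.reverse.support_nodup
  rw [← cons_tail_support, List.nodup_cons] at n1 n2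
  have hne : x ≠ y := by
    rintro rfl
    exact n1.1 (A.end_mem_tail_support (by rw [← length_eq_zero_iff]; omega))
  have hPpos : 0 < P.length := by
    by_contra! hc
    exact hne (eq_of_length_eq_zero (p := P) (by omega))
  refine hAp.isCycle_append hPp.reverse ?_ (Or.inl (by omega))
  intro w hw1 hw2
  rcases key w (List.mem_of_mem_tail hw1) (by simpa using List.mem_of_mem_tail hw2) with rfl | rfl
  · exact n1.1 hw1
  · exact n2.1 hw2

end ShortCycles

open ShortCycles SimpleGraph Walk in
/-- Let `ℓ ≥ 1` and `g ≥ 2ℓ - 1`. If `G` is a finite connected graph of diameter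
strictly less than `g/2` (i.e. `2·dist(u,v) < g` for all vertices `u, v`) in which every
cycle has length `< ℓ` or `> g`, then every cycle of `G` has length `< ℓ`. -/
theorem short_cycles_of_small_diameter {V : Type*} [Fintype V] (G : SimpleGraph V)
    (ℓ g : ℕ) (hℓ : 1 ≤ ℓ) (hg : 2 * ℓ - 1 ≤ g)
    (hconn : G.Connected)
    (hdiam : ∀ u v : V, 2 * G.dist u v < g)
    (hcyc : ∀ (v : V) (w : G.Walk v v), w.IsCycle → w.length < ℓ ∨ g < w.length) :
    ∀ (v : V) (w : G.Walk v v), w.IsCycle → w.length < ℓ := by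
  classical
  by_contra! hcon
  have hex : ∃ L, ℓ ≤ L ∧ ∃ (v : V) (w : G.Walk v v), w.IsCycle ∧ w.length = L := by
    obtain ⟨v, w, hw, hl⟩ := hcon
    exact ⟨_, hl, v, w, hw, rfl⟩
  have hmin := fun m => Nat.find_min hex (m := m)
  obtain ⟨hL, v, w, hw, hwL⟩ := Nat.find_spec hex
  generalize Nat.find hex = L at *
  have hgL : g < L := by
    rcases hcyc v w hw with h | h <;> omega
  have hex2 : ∃ d, ∃ (x y : V) (A : G.Walk x y) (B : G.Walk y x), Split G L A B ∧
      G.dist x y = d := by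
    have e := w.append_take_drop_eq (L / 2)
    have e2 := congrArg Walk.length e
    rw [length_append] at e2
    have e3 : (w.take (L / 2)).length = L / 2 := by rw [take_length]; omega
    have hd := hdiam v (w.getVert (L / 2))
    exact ⟨_, v, w.getVert (L / 2), w.take (L / 2), w.drop (L / 2),
      ⟨by rw [e]; exact hw, by omega, by omega, by omega⟩, rfl⟩
  have hmin2 := fun m => Nat.find_min' hex2 (m := m)
  obtain ⟨x, y, A, B, hS, hd⟩ := Nat.find_spec hex2
  rw [← hd] at hmin2
  obtain ⟨P, hP⟩ := hconn.exists_walk_length_eq_dist x y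
  have c1 := cycle_of_min hS (fun x' y' A' B' h => hmin2 _ ⟨x', y', A', B', h, rfl⟩) P hP
  have c2 := cycle_of_min hS.swap
    (fun x' y' A' B' h => by rw [SimpleGraph.dist_comm]; exact hmin2 _ ⟨x', y', A', B', h, rfl⟩)
    P.reverse (by rw [length_reverse, hP, SimpleGraph.dist_comm])
  obtain ⟨-, h2, h3, h4⟩ := hS
  have l1 : (A.append P.reverse).length < ℓ := by
    by_contra! hc
    exact hmin _ (by rw [length_append, length_reverse]; omega) ⟨hc, _, _, c1, rfl⟩
  have l2 : (B.append P.reverse.reverse).length < ℓ := by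
    by_contra! hc
    exact hmin _ (by rw [length_append, length_reverse, length_reverse]; omega)
      ⟨hc, _, _, c2, rfl⟩
  rw [length_append] at l1 l2
  omega
end

section
/- Let G be a finite graph, let C be a cycle of G of minimum length among all cycles of G, and let v be a vertex of G not lying on C. Then v has at most 3 neighbours on C. -/
theorem short_arc_aux {V : Type*} (G : SimpleGraph V)
    (v : V) (c : G.Walk v v) (hc : c.IsCycle)
    (hmin : ∀ (u : V) (w : G.Walk u u), w.IsCycle → c.length ≤ w.length)
    (x : V) (hx : x ∉ c.support) (i j : ℕ) (hij : i < j) (hj : j < c.length)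
    (hi' : G.Adj x (c.getVert i)) (hj' : G.Adj x (c.getVert j)) :
    c.length ≤ j - i + 2 := by
  have hp : (c.take j).IsPath := hc.isPath_take hj
  have hq : ((c.take j).drop i).IsPath := hp.drop i
  have e : (c.take j).getVert i = c.getVert i := by
    rw [SimpleGraph.Walk.take_getVert, min_eq_right hij.le]
  have hlen : ((c.take j).drop i).length = j - i := by
    simp only [SimpleGraph.Walk.drop_length, SimpleGraph.Walk.take_length]
    omega
  have hxq : x ∉ ((c.take j).drop i).support := fun h =>
    hx ((c.isSubwalk_take j).support_subset (((c.take j).isSubwalk_drop i).support_subset h))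
  have hne : c.getVert i ≠ c.getVert j := by
    intro h
    have := hc.getVert_injOn' (x₁ := i) (x₂ := j) (by simp; omega) (by simp; omega) h
    omega
  rw [← e] at hi' hne
  generalize (c.take j).drop i = q at *
  have hcyc : (SimpleGraph.Walk.cons hi' (q.concat hj'.symm)).IsCycle := by
    rw [SimpleGraph.Walk.cons_isCycle_iff]
    refine ⟨hq.concat hxq _, ?_⟩
    rw [SimpleGraph.Walk.edges_concat]
    simp only [List.concat_eq_append, List.mem_append, List.mem_singleton, not_or]
    refine ⟨fun h => hxq (q.fst_mem_support_of_mem_edges h), ?_⟩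
    intro h
    rw [Sym2.eq_iff] at h
    rcases h with ⟨h1, h2⟩ | ⟨h1, h2⟩
    · exact hne (h2.trans h1)
    · exact hne h2
  have := hmin _ _ hcyc
  simp only [SimpleGraph.Walk.length_cons, SimpleGraph.Walk.length_concat] at this
  omega


/-- If `C` is a shortest cycle of a finite graph `G` and `x` is a vertex not on `C`,
then `x` has at most `3` neighbours on `C`. -/
theorem shortest_cycle_few_neighbors {V : Type*} [Fintype V] (G : SimpleGraph V)
    (v : V) (c : G.Walk v v) (hc : c.IsCycle)
    (hmin : ∀ (u : V) (w : G.Walk u u), w.IsCycle → c.length ≤ w.length)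
    (x : V) (hx : x ∉ c.support) :
    {u | u ∈ c.support ∧ G.Adj x u}.ncard ≤ 3 := by
  classical
  have h3 := hc.three_le_length
  have key := short_arc_aux G v c hc hmin x hx
  let S := (Finset.range c.length).filter (fun i => G.Adj x (c.getVert i))
  have hsub : {u | u ∈ c.support ∧ G.Adj x u} ⊆ ((S.image c.getVert : Finset V) : Set V) := by
    rintro u ⟨hu, hau⟩
    obtain ⟨n, rfl, hn⟩ := SimpleGraph.Walk.mem_support_iff_exists_getVert.1 hu
    simp only [Finset.coe_image, Set.mem_image, Finset.mem_coe]
    rcases hn.lt_or_eq with h | h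
    · exact ⟨n, by simp [S, h, hau], rfl⟩
    · subst h
      refine ⟨0, ?_, by simp⟩
      simp only [SimpleGraph.Walk.getVert_length] at hau
      simp [S, hau]
      omega
  have hcard : S.card ≤ 3 := by
    by_contra! h
    have h4 : S.card ≤ c.length := (Finset.card_filter_le _ _).trans (by simp)
    obtain ⟨a, b, d, ha, hb, hd, hab, had, hbd⟩ := Finset.two_lt_card_iff.1 (by omega : 2 < S.card)
    simp only [S, Finset.mem_filter, Finset.mem_range] at ha hb hd
    have g : ∀ i j, (i < c.length ∧ G.Adj x (c.getVert i)) →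
        (j < c.length ∧ G.Adj x (c.getVert j)) → i < j → c.length ≤ j - i + 2 :=
      fun i j hi hj hij => key i j hij hj.1 hi.2 hj.2
    have := g a b ha hb
    have := g b a hb ha
    have := g a d ha hd
    have := g d a hd ha
    have := g b d hb hd
    have := g d b hd hb
    omega
  calc _ ≤ ((S.image c.getVert : Finset V) : Set V).ncard :=
        Set.ncard_le_ncard hsub (Finset.finite_toSet _)
    _ = (S.image c.getVert).card := Set.ncard_coe_finset _
    _ ≤ S.card := Finset.card_image_le
    _ ≤ 3 := hcard
end

section
/- Let ℓ ≥ 3 be an integer, let G be a finite graph containing a cycle of length at least ℓ, let C be a cycle of minimum length among all cycles of G of length at least ℓ, and let v be a vertex of G not lying on C. Then v has at most ℓ neighbours on C. -/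
/-- Let `ℓ ≥ 3` and let `C` be a shortest cycle among all cycles of `G` of length at
least `ℓ`. Then every vertex `x` not on `C` has at most `ℓ` neighbours on `C`. -/
theorem shortest_long_cycle_few_neighbors {V : Type*} [Fintype V] (G : SimpleGraph V)
    (ℓ : ℕ) (hℓ : 3 ≤ ℓ) (v : V) (c : G.Walk v v) (hc : c.IsCycle) (hlong : ℓ ≤ c.length)
    (hmin : ∀ (u : V) (w : G.Walk u u), w.IsCycle → ℓ ≤ w.length → c.length ≤ w.length)
    (x : V) (hx : x ∉ c.support) :
    {u | u ∈ c.support ∧ G.Adj x u}.ncard ≤ ℓ := by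
  classical
  rcases Set.eq_empty_or_nonempty {u | u ∈ c.support ∧ G.Adj x u} with h0 | ⟨a, ha, hxa⟩
  · rw [h0]; simp
  have hd : (c.rotate a ha).IsCycle := hc.rotate ha
  have hlen : (c.rotate a ha).length = c.length := c.length_rotate a ha
  have hsup : ∀ w, w ∈ (c.rotate a ha).support ↔ w ∈ c.support :=
    fun w => c.mem_support_rotate_iff a ha
  generalize c.rotate a ha = d at hd hlen hsup
  -- all neighbours sit at positions `0, …, ℓ - 3, n - 2, n - 1` of the rotated cycle
  have hsub : {u | u ∈ c.support ∧ G.Adj x u} ⊆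
      ((Finset.range (ℓ - 2) ∪ {c.length - 2, c.length - 1}).image d.getVert : Finset V) := by
    rintro u ⟨hu, hxu⟩
    rw [Finset.mem_coe, Finset.mem_image]
    by_cases hua : u = a
    · exact ⟨0, by simp; omega, by simp [hua]⟩
    have hud : u ∈ d.support := (hsup u).2 hu
    have hlt := SimpleGraph.Walk.length_takeUntil_lt_length hud hua
    refine ⟨(d.takeUntil u hud).length, ?_, SimpleGraph.Walk.getVert_length_takeUntil hud⟩
    have hpath := hd.isPath_takeUntil hud
    have hxq : x ∉ (d.takeUntil u hud).support := fun h =>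
      hx ((hsup x).1 (d.support_takeUntil_subset_support hud h))
    have hcyc : (SimpleGraph.Walk.cons hxa ((d.takeUntil u hud).concat hxu.symm)).IsCycle := by
      rw [SimpleGraph.Walk.cons_isCycle_iff]
      refine ⟨hpath.concat hxq hxu.symm, ?_⟩
      rw [SimpleGraph.Walk.edges_concat, List.concat_eq_append, List.mem_append]
      rintro (h | h)
      · exact hxq (SimpleGraph.Walk.fst_mem_support_of_mem_edges _ h)
      · have hne := hxa.ne
        simp only [List.mem_singleton, Sym2.eq_iff] at h
        rcases h with ⟨h1, h2⟩ | ⟨-, h2⟩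
        · exact hne h2.symm
        · exact hua h2.symm
    have hm := hmin x _ hcyc
    simp only [SimpleGraph.Walk.length_cons, SimpleGraph.Walk.length_concat] at hm
    simp only [Finset.mem_union, Finset.mem_range, Finset.mem_insert, Finset.mem_singleton]
    omega
  refine (Set.ncard_le_ncard hsub (Finset.finite_toSet _)).trans ?_
  rw [Set.ncard_coe_finset]
  refine Finset.card_image_le.trans ((Finset.card_union_le _ _).trans ?_)
  have := Finset.card_le_two (a := c.length - 2) (b := c.length - 1)
  rw [Finset.card_range]
  omega
end
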